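/- arXiv:1005.2247 — 3 statements merged into one kernel-verified Lean document; each statement's English description precedes it below -/
import Mathlib

section
/- Let X be a real Banach space, let A : X ⇉ X* be maximal monotone of type (FPV) with convex domain, and let C be a nonempty closed convex subset of X with dom A ∩ int C ≠ ∅. Then A + N_C is of type (FPV). -/
open Set Filter Pointwise

noncomputable section

variable {X : Type*}

abbrev Dual' (X : Type*) [NormedAddCommGroup X] [NormedSpace ℝ X] := X →L[ℝ] ℝ

section Defs
variable [NormedAddCommGroup X] [NormedSpace ℝ X]

/-- `A` is a monotone operator. -/
def MonotoneOp (A : X → Set (Dual' X)) : Prop :=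
  ∀ x y (x' y' : Dual' X), x' ∈ A x → y' ∈ A y → 0 ≤ (x' - y') (x - y)

/-- `A` is maximal monotone: monotone, and every monotonically related pair is in the graph. -/
def MaxMonotone (A : X → Set (Dual' X)) : Prop :=
  MonotoneOp A ∧
    ∀ x (x' : Dual' X), (∀ y y', y' ∈ A y → 0 ≤ (x' - y') (x - y)) → x' ∈ A x

/-- domain of a set-valued operator -/
def domOp (A : X → Set (Dual' X)) : Set X := {x | (A x).Nonempty}

/-- pointwise Minkowski sum of two set-valued operators -/
def opSum (A B : X → Set (Dual' X)) : X → Set (Dual' X) := fun x => A x + B x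

/-- normal cone operator of a set `C` -/
def normalCone (C : Set X) : X → Set (Dual' X) :=
  fun x => {x' | x ∈ C ∧ ∀ c ∈ C, x' (c - x) ≤ 0}

/-- the Fitzpatrick function of `A` -/
def fitz (A : X → Set (Dual' X)) : X × Dual' X → EReal :=
  fun p => ⨆ q ∈ {q : X × Dual' X | q.2 ∈ A q.1},
    ((q.2 p.1 + p.2 q.1 - q.2 q.1 : ℝ) : EReal)

/-- `A` is maximal monotone of type (FPV) -/
def FPV (A : X → Set (Dual' X)) : Prop :=
  MaxMonotone A ∧
    ∀ U : Set X, IsOpen U → Convex ℝ U → (U ∩ domOp A).Nonempty →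
      ∀ x (x' : Dual' X), x ∈ U →
        (∀ y y', y' ∈ A y → y ∈ U → 0 ≤ (x' - y') (x - y)) → x' ∈ A x

/-- `A` is a linear relation: its graph is a linear subspace of `X × X*` -/
def LinearRel (A : X → Set (Dual' X)) : Prop :=
  (0 : Dual' X) ∈ A 0 ∧
  (∀ x y (x' y' : Dual' X), x' ∈ A x → y' ∈ A y → x' + y' ∈ A (x + y)) ∧
  (∀ (c : ℝ) x (x' : Dual' X), x' ∈ A x → c • x' ∈ A (c • x))

/-- subdifferential of an extended-real-valued function -/
def subdiff (f : X → EReal) : X → Set (Dual' X) :=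
  fun x => {x' | ∀ y, ((x' (y - x) : ℝ) : EReal) + f x ≤ f y}

/-- `f` is proper: never `⊥` and not identically `⊤` -/
def ProperFun (f : X → EReal) : Prop := (∀ x, f x ≠ ⊥) ∧ ∃ x, f x ≠ ⊤

/-- convexity for extended-real-valued functions -/
def EConvexOn (f : X → EReal) : Prop :=
  ∀ x y (t : ℝ), 0 ≤ t → t ≤ 1 →
    f (t • x + (1 - t) • y) ≤ (t : EReal) * f x + ((1 - t : ℝ) : EReal) * f y

/-- effective domain of an extended-real-valued function -/
def domFun (f : X → EReal) : Set X := {x | f x ≠ ⊤}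

end Defs

theorem eventually_segment_mem_interior_inter {X : Type*} [NormedAddCommGroup X]
    [NormedSpace ℝ X] {C U : Set X} (hC : Convex ℝ C) (hU : IsOpen U) {z p : X}
    (hzC : z ∈ C) (hzU : z ∈ U) (hp : p ∈ interior C) :
    ∀ᶠ t : ℝ in nhdsWithin 0 (Ioi 0),
      0 < t ∧ t ≤ 1 ∧ z + t • (p - z) ∈ interior C ∧ z + t • (p - z) ∈ U := by
  have h0 : ∀ᶠ t : ℝ in nhdsWithin 0 (Ioi 0), t ∈ Ioc (0 : ℝ) 1 :=
    Ioc_mem_nhdsGT one_pos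
  have hcont : Continuous fun t : ℝ => z + t • (p - z) := by fun_prop
  have h1 : ∀ᶠ t : ℝ in nhdsWithin 0 (Ioi 0), z + t • (p - z) ∈ U :=
    nhdsWithin_le_nhds (hcont.continuousAt.preimage_mem_nhds (hU.mem_nhds (by simpa using hzU)))
  filter_upwards [h0, h1] with t ht htU
  exact ⟨ht.1, ht.2, hC.add_smul_sub_mem_interior hzC hp ht, htU⟩

theorem Convex.le_of_forall_interior_le {X : Type*} [NormedAddCommGroup X] [NormedSpace ℝ X]
    {C : Set X} (hC : Convex ℝ C) (hne : (interior C).Nonempty) {f : Dual' X} {β : ℝ}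
    (h : ∀ p ∈ interior C, f p ≤ β) {c : X} (hc : c ∈ C) : f c ≤ β := by
  have hcl : c ∈ closure (interior C) := by
    rw [hC.closure_interior_eq_closure_of_nonempty_interior hne]
    exact subset_closure hc
  exact closure_minimal (t := {x | f x ≤ β}) h (isClosed_le f.continuous continuous_const) hcl

/-- The pairs `(p, α)` for which some functional `q` makes `α` bound the Fitzpatrick function of
`A`, recentred at `(z, z')`, at the point `(p - z, q)`. -/
def fitzEpi {X : Type*} [NormedAddCommGroup X] [NormedSpace ℝ X] (A : X → Set (Dual' X))
    (z : X) (z' : Dual' X) : Set (X × ℝ) :=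
  {e | ∃ q : Dual' X, ∀ c c', c' ∈ A c →
    (c' - z') (e.1 - z) + q (c - z) - (c' - z') (c - z) ≤ e.2}

theorem convex_fitzEpi {X : Type*} [NormedAddCommGroup X] [NormedSpace ℝ X]
    (A : X → Set (Dual' X)) (z : X) (z' : Dual' X) : Convex ℝ (fitzEpi A z z') := by
  rintro ⟨p₁, α₁⟩ ⟨q₁, h₁⟩ ⟨p₂, α₂⟩ ⟨q₂, h₂⟩ s t hs ht hst
  refine ⟨s • q₁ + t • q₂, fun c c' hc => ?_⟩
  have e₁ := mul_le_mul_of_nonneg_left (h₁ c c' hc) hs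
  have e₂ := mul_le_mul_of_nonneg_left (h₂ c c' hc) ht
  obtain rfl : s = 1 - t := by linarith
  simp only [map_sub, map_add, map_smul, sub_apply,
    add_apply, smul_apply, smul_eq_mul,
    Prod.smul_mk, Prod.mk_add_mk] at e₁ e₂ ⊢
  linarith

theorem MonotoneOp.mem_fitzEpi {X : Type*} [NormedAddCommGroup X] [NormedSpace ℝ X]
    {A : X → Set (Dual' X)} (hA : MonotoneOp A) (z : X) (z' : Dual' X) {a : X} {a' : Dual' X}
    (ha : a' ∈ A a) : (a, (a' - z') (a - z)) ∈ fitzEpi A z z' := by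
  refine ⟨a' - z', fun c c' hc => ?_⟩
  have := hA a c a' c' ha hc
  simp only [map_sub, sub_apply] at this ⊢
  linarith

theorem FPV.nonneg_of_mem_fitzEpi {X : Type*} [NormedAddCommGroup X] [NormedSpace ℝ X]
    {A : X → Set (Dual' X)} (hA : FPV A) {C U : Set X} (hC : Convex ℝ C) (hU : IsOpen U)
    (hUc : Convex ℝ U) (hne : (U ∩ interior C ∩ domOp A).Nonempty) {z : X} {z' : Dual' X}
    (hzC : z ∈ C) (hzU : z ∈ U)
    (hrel : ∀ a a', a' ∈ A a → a ∈ U → a ∈ interior C → 0 ≤ (a' - z') (a - z))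
    {p : X} {α : ℝ} (hp : p ∈ interior C) (hpα : (p, α) ∈ fitzEpi A z z') : 0 ≤ α := by
  by_contra! hα
  obtain ⟨q, hq⟩ := hpα
  have hlim : ∀ᶠ t : ℝ in nhdsWithin 0 (Ioi 0), α < 2 * (t * q (p - z)) := by
    have hcont : Continuous fun t : ℝ => 2 * (t * q (p - z)) := by fun_prop
    exact nhdsWithin_le_nhds
      (hcont.continuousAt.preimage_mem_nhds (Ioi_mem_nhds (by simpa using hα)))
  obtain ⟨t, ⟨ht0, ht1, htC, htU⟩, hαt⟩ :=
    ((eventually_segment_mem_interior_inter hC hU hzC hzU hp).and hlim).exists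
  have hmem : z' + t • q ∈ A (z + t • (p - z)) := by
    refine hA.2 (U ∩ interior C) (hU.inter isOpen_interior) (hUc.inter hC.interior) hne _ _
      ⟨htU, htC⟩ fun c c' hc hcV => ?_
    have e₁ := mul_le_mul_of_nonneg_left (hq c c' hc) ht0.le
    have e₂ := mul_nonneg (sub_nonneg.2 ht1) (hrel c c' hc hcV.1 hcV.2)
    have e₃ : t * α ≤ t * (t * q (p - z)) :=
      mul_le_mul_of_nonneg_left (by linarith) ht0.le
    simp only [map_sub, map_add, map_smul, sub_apply,
      add_apply, smul_apply, smul_eq_mul] at e₁ e₂ e₃ ⊢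
    linarith
  have h := hq _ _ hmem
  simp only [add_sub_cancel_left, map_smul, smul_apply, smul_eq_mul] at h
  nlinarith [sq_nonneg t]

theorem exists_separating_graph {X : Type*} [NormedAddCommGroup X] [NormedSpace ℝ X]
    {V : Set X} (hV : Convex ℝ V) (hVo : IsOpen V) {S : Set (X × ℝ)} (hS : Convex ℝ S)
    (h : ∀ p ∈ V, ∀ α, (p, α) ∈ S → 0 ≤ α) :
    ∃ (n : Dual' X) (r β : ℝ),
      (∀ p ∈ V, ∀ s < 0, n p + r * s < β) ∧ ∀ p s, (p, s) ∈ S → β ≤ n p + r * s := by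
  have hdisj : Disjoint (V ×ˢ Iio (0 : ℝ)) S := by
    rw [Set.disjoint_left]
    rintro ⟨p, α⟩ ⟨hp, hα⟩ hmem
    exact (h p hp α hmem).not_gt hα
  obtain ⟨f, β, hf₁, hf₂⟩ :=
    geometric_hahn_banach_open (hV.prod (convex_Iio 0)) (hVo.prod isOpen_Iio) hS hdisj
  have hf : ∀ p s, f (p, s) = f (p, 0) + f (0, 1) * s := by
    intro p s
    have h : ((p, s) : X × ℝ) = (p, 0) + s • ((0, 1) : X × ℝ) := by simp
    rw [h, map_add, map_smul, smul_eq_mul, mul_comm]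
  refine ⟨f.comp (ContinuousLinearMap.inl ℝ X ℝ), f (0, 1), β, fun p hp s hs => ?_,
    fun p s hps => ?_⟩
  · have := hf₁ (p, s) ⟨hp, hs⟩
    rw [hf] at this
    simpa using this
  · have := hf₂ (p, s) hps
    rw [hf] at this
    simpa using this

/-- A pair over a point of `C` which is monotonically related to `A` over the part of the interior
of `C` in `U` lies in the graph of `A + N_C`. -/
theorem FPV.mem_opSum_normalCone {X : Type*} [NormedAddCommGroup X] [NormedSpace ℝ X]
    {A : X → Set (Dual' X)} (hA : FPV A) {C U : Set X} (hC : Convex ℝ C) (hU : IsOpen U)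
    (hUc : Convex ℝ U) (hne : (U ∩ interior C ∩ domOp A).Nonempty) {z : X} {z' : Dual' X}
    (hzC : z ∈ C) (hzU : z ∈ U)
    (hrel : ∀ a a', a' ∈ A a → a ∈ U → a ∈ interior C → 0 ≤ (a' - z') (a - z)) :
    z' ∈ opSum A (normalCone C) z := by
  obtain ⟨n, r, β, hup, hlow'⟩ := exists_separating_graph hC.interior isOpen_interior
    (convex_fitzEpi A z z') fun p hp α hmem =>
      hA.nonneg_of_mem_fitzEpi hC hU hUc hne hzC hzU hrel hp hmem
  have hlow : ∀ a a', a' ∈ A a → β ≤ n a + r * (a' - z') (a - z) := fun a a' ha =>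
    hlow' _ _ (hA.1.1.mem_fitzEpi z z' ha)
  obtain ⟨b, ⟨hbU, hbC⟩, b', hb⟩ := hne
  have hr0 : 0 < r := by
    have h₁ := hlow b b' hb
    have h₂ := hup b hbC (-1) (by norm_num)
    have h₃ := hrel b b' hb hbU hbC
    by_contra! hr
    nlinarith
  have hnC : ∀ c ∈ C, n c ≤ β := fun c hc => by
    refine hC.le_of_forall_interior_le ⟨b, hbC⟩ (fun p hp => ?_) hc
    refine le_of_forall_pos_lt_add fun ε hε => ?_
    have := hup p hp (-(ε / r)) (by simpa using div_pos hε hr0)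
    have e : r * -(ε / r) = -ε := by field_simp
    linarith
  have hz : z' - r⁻¹ • n ∈ A z := by
    refine hA.1.2 _ _ fun a a' ha => ?_
    have h := (hnC z hzC).trans (hlow a a' ha)
    have h' : 0 ≤ r⁻¹ * (n a - n z + r * (a' - z') (a - z)) :=
      mul_nonneg (inv_nonneg.2 hr0.le) (by linarith)
    rw [mul_add, inv_mul_cancel_left₀ hr0.ne'] at h'
    simp only [map_sub, sub_apply, smul_apply,
      smul_eq_mul] at h' ⊢
    linarith
  refine ⟨_, hz, r⁻¹ • n, ⟨hzC, fun c hc => ?_⟩, sub_add_cancel _ _⟩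
  have h₁ : β ≤ n z := by simpa using hlow z _ hz
  have h₂ : n (c - z) ≤ 0 := by
    rw [map_sub]
    linarith [hnC c hc]
  exact mul_nonpos_of_nonneg_of_nonpos (inv_nonneg.2 hr0.le) h₂

theorem MonotoneOp.opSum_normalCone {X : Type*} [NormedAddCommGroup X] [NormedSpace ℝ X]
    {A : X → Set (Dual' X)} (hA : MonotoneOp A) (C : Set X) :
    MonotoneOp (opSum A (normalCone C)) := by
  rintro x y _ _ ⟨a, ha, n, hn, rfl⟩ ⟨b, hb, m, hm, rfl⟩
  have h₁ := hA x y a b ha hb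
  have h₂ := hn.2 y hm.1
  have h₃ := hm.2 x hn.1
  simp only [map_sub, sub_apply, add_apply] at *
  linarith

/-- If `(z, z')` is monotonically related to `A + N_C` over `U`, then adjoining `z` to `C` gains no
point of the domain of `A` in `U`. -/
theorem mem_of_mem_convexHull_insert {X : Type*} [NormedAddCommGroup X] [NormedSpace ℝ X]
    {A : X → Set (Dual' X)} (hdom : Convex ℝ (domOp A)) {C U : Set X} (hCcl : IsClosed C)
    (hC : Convex ℝ C) (hUc : Convex ℝ U) (hne : (U ∩ interior C ∩ domOp A).Nonempty)
    {z : X} {z' : Dual' X}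
    (hrel : ∀ y y', y' ∈ opSum A (normalCone C) y → y ∈ U → 0 ≤ (z' - y') (z - y))
    {a : X} (ha : a ∈ domOp A) (haU : a ∈ U) (haC : a ∈ convexHull ℝ (insert z C)) : a ∈ C := by
  by_contra haC'
  obtain ⟨b, ⟨hbU, hbC⟩, hb⟩ := hne
  have hbC' := interior_subset hbC
  obtain ⟨w, hw, hwC, hwi⟩ : ∃ w ∈ segment ℝ a b, w ∈ C ∧ w ∉ interior C := by
    by_contra! h
    obtain ⟨x, -, hxi, hxC⟩ := (convex_segment a b).isPreconnected (interior C) Cᶜ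
      isOpen_interior hCcl.isOpen_compl
      (fun x hx => (em (x ∈ C)).imp (h x hx) id)
      ⟨b, right_mem_segment ℝ a b, hbC⟩ ⟨a, left_mem_segment ℝ a b, haC'⟩
    exact hxC (interior_subset hxi)
  obtain ⟨n, hn⟩ := geometric_hahn_banach_open_point hC.interior isOpen_interior hwi
  have hnC : ∀ c ∈ C, n c ≤ n w := fun c hc =>
    hC.le_of_forall_interior_le ⟨b, hbC⟩ (fun p hp => (hn p hp).le) hc
  obtain ⟨w', hw'⟩ : w ∈ domOp A := hdom.segment_subset ha hb hw
  have hwU : w ∈ U := hUc.segment_subset haU hbU hw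
  have hnwa : n w < n a := by
    obtain ⟨s, t, hs, ht, hst, rfl⟩ := hw
    have hnb := hn b hbC
    simp only [map_add, map_smul, smul_eq_mul] at hnb ⊢
    obtain rfl | ht := ht.eq_or_lt
    · obtain rfl : s = 1 := by linarith
      simp [haC'] at hwC
    · obtain rfl : s = 1 - t := by linarith
      by_contra! h
      nlinarith
  have hnwz : n w < n z := by
    rw [convexHull_insert ⟨b, hbC'⟩, hC.convexHull_eq, mem_convexJoin] at haC
    obtain ⟨_, rfl, c, hc, s, t, hs, ht, hst, rfl⟩ := haC
    have hnc := hnC c hc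
    simp only [map_add, map_smul, smul_eq_mul] at hnwa
    obtain rfl : s = 1 - t := by linarith
    by_contra! h
    nlinarith
  have key : ∀ r : ℝ, 0 ≤ r → r * (n z - n w) ≤ (z' - w') (z - w) := by
    intro r hr
    have hmem : w' + r • n ∈ opSum A (normalCone C) w := by
      refine ⟨w', hw', r • n, ⟨hwC, fun c hc => ?_⟩, rfl⟩
      have h : n (c - w) ≤ 0 := by
        rw [map_sub]
        linarith [hnC c hc]
      exact mul_nonpos_of_nonneg_of_nonpos hr h
    have := hrel w _ hmem hwU
    simp only [map_sub, sub_apply, add_apply,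
      smul_apply, smul_eq_mul] at this ⊢
    linarith
  have hpos : 0 < n z - n w := sub_pos.2 hnwz
  have h₀ := key 0 le_rfl
  have h₁ := key (((z' - w') (z - w) + 1) / (n z - n w)) (div_nonneg (by linarith) hpos.le)
  rw [div_mul_cancel₀ _ hpos.ne'] at h₁
  linarith

theorem FPV.mem_opSum_normalCone_of_related {X : Type*} [NormedAddCommGroup X]
    [NormedSpace ℝ X] {A : X → Set (Dual' X)} (hA : FPV A) (hdom : Convex ℝ (domOp A))
    {C U : Set X} (hCcl : IsClosed C) (hC : Convex ℝ C) (hint : (domOp A ∩ interior C).Nonempty)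
    (hU : IsOpen U) (hUc : Convex ℝ U) (hne : (U ∩ domOp (opSum A (normalCone C))).Nonempty)
    {z : X} {z' : Dual' X} (hzU : z ∈ U)
    (hrel : ∀ y y', y' ∈ opSum A (normalCone C) y → y ∈ U → 0 ≤ (z' - y') (z - y)) :
    z' ∈ opSum A (normalCone C) z := by
  have hne' : (U ∩ interior C ∩ domOp A).Nonempty := by
    obtain ⟨u, huU, _, u', hu, _, ⟨huC, -⟩, -⟩ := hne
    obtain ⟨a, ha, haC⟩ := hint
    obtain ⟨t, ht0, ht1, htC, htU⟩ :=
      (eventually_segment_mem_interior_inter hC hU huC huU haC).exists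
    exact ⟨_, ⟨htU, htC⟩, hdom.add_smul_sub_mem ⟨u', hu⟩ ha ⟨ht0.le, ht1⟩⟩
  set D := convexHull ℝ (insert z C)
  have hCD : C ⊆ D := (subset_insert z C).trans (subset_convexHull ℝ _)
  have hzD : z ∈ D := subset_convexHull ℝ _ (mem_insert z C)
  have hDC : ∀ a ∈ domOp A, a ∈ U → a ∈ D → a ∈ C := fun a ha haU haD =>
    mem_of_mem_convexHull_insert hdom hCcl hC hUc hne' hrel ha haU haD
  obtain ⟨a', ha, n, hn, rfl⟩ := hA.mem_opSum_normalCone (C := D) (z' := z')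
    (convex_convexHull ℝ _) hU hUc
    (hne'.mono (by gcongr)) hzD hzU
    fun a a' ha haU haD => by
      have haC := hDC a ⟨a', ha⟩ haU (interior_subset haD)
      have := hrel a a' ⟨a', ha, 0, ⟨haC, by simp⟩, add_zero _⟩ haU
      simp only [map_sub, sub_apply] at this ⊢
      linarith
  exact ⟨a', ha, n, ⟨hDC z ⟨a', ha⟩ hzU hzD, fun c hc => hn.2 c (hCD hc)⟩, rfl⟩

variable [NormedAddCommGroup X] [NormedSpace ℝ X] [CompleteSpace X]

theorem stmt3 (A : X → Set (Dual' X)) (hA : FPV A) (hdom : Convex ℝ (domOp A))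
    (C : Set X) (hCne : C.Nonempty) (hCcl : IsClosed C) (hCconv : Convex ℝ C)
    (hint : (domOp A ∩ interior C).Nonempty) :
    FPV (opSum A (normalCone C)) := by
  refine ⟨⟨hA.1.1.opSum_normalCone C, fun z z' hrel => ?_⟩, fun U hU hUc hne z z' hzU hrel => ?_⟩
  · obtain ⟨b, ⟨b', hb⟩, hbC⟩ := hint
    exact hA.mem_opSum_normalCone_of_related hdom hCcl hCconv ⟨b, ⟨b', hb⟩, hbC⟩ isOpen_univ
      convex_univ
      ⟨b, mem_univ b, b', b', hb, 0, ⟨interior_subset hbC, by simp⟩, add_zero _⟩ (mem_univ z)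
      fun y y' hy _ => hrel y y' hy
  · exact hA.mem_opSum_normalCone_of_related hdom hCcl hCconv hint hU hUc hne hzU hrel
end
end

section
/- (Main Theorem) Let X be a real Banach space and let A, B : X ⇉ X* be maximal monotone operators with dom A ∩ int dom B ≠ ∅. Assume that A + N_{cl(dom B)} is maximal monotone of type (FPV) and that dom A ∩ cl(dom B) ⊆ dom B. Then A + B is maximal monotone. -/
open Set Filter Pointwise

noncomputable section

variable {X : Type*}

section Sum
variable [NormedAddCommGroup X] [NormedSpace ℝ X]

/-- `c` is an upper bound for the value at `(x, x')` of the Fitzpatrick function of `T`. -/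
def FitzLe (T : X → Set (Dual' X)) (x : X) (x' : Dual' X) (c : ℝ) : Prop :=
  ∀ y y', y' ∈ T y → x' y + y' x - y' y ≤ c

/-- `B` is everywhere defined and bounded by `M` on the closed ball of radius `r` around `x₀`. -/
def BoundedOnBall (B : X → Set (Dual' X)) (x₀ : X) (r M : ℝ) : Prop :=
  ∀ x, ‖x - x₀‖ ≤ r → x ∈ domOp B ∧ ∀ x' ∈ B x, ‖x'‖ ≤ M

theorem opNorm_le_of_forall_le {f : Dual' X} {N : ℝ} (h : ∀ e, ‖e‖ ≤ 1 → f e ≤ N) : ‖f‖ ≤ N := by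
  have hN : 0 ≤ N := by simpa using h 0 (by simp)
  refine ContinuousLinearMap.opNorm_le_of_unit_norm hN fun x hx => ?_
  rw [Real.norm_eq_abs, abs_le]
  have h1 := h x hx.le
  have h2 := h (-x) (by rw [norm_neg]; exact hx.le)
  rw [map_neg] at h2
  constructor <;> linarith

theorem neg_mul_norm_le_apply {f : Dual' X} {M : ℝ} (h : ‖f‖ ≤ M) (v : X) : -(M * ‖v‖) ≤ f v := by
  have h1 := f.le_of_opNorm_le h v
  rw [Real.norm_eq_abs, abs_le] at h1
  exact h1.1

theorem apply_le_mul_norm {f : Dual' X} {M : ℝ} (h : ‖f‖ ≤ M) (v : X) : f v ≤ M * ‖v‖ :=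
  (le_abs_self _).trans (f.le_of_opNorm_le h v)

theorem FitzLe.convex_comb {T : X → Set (Dual' X)} {x y : X} {x' y' : Dual' X} {c d s t : ℝ}
    (hx : FitzLe T x x' c) (hy : FitzLe T y y' d) (hs : 0 ≤ s) (ht : 0 ≤ t) (hst : s + t = 1) :
    FitzLe T (s • x + t • y) (s • x' + t • y') (s * c + t * d) := by
  intro w w' hw
  have h1 := mul_le_mul_of_nonneg_left (hx w w' hw) hs
  have h2 := mul_le_mul_of_nonneg_left (hy w w' hw) ht
  simp only [map_add, map_smul, add_apply, smul_apply,
    smul_eq_mul]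
  linear_combination h1 + h2 + (w' w) * hst

theorem FitzLe.of_mem {T : X → Set (Dual' X)} (hT : MonotoneOp T) {x : X} {x' : Dual' X}
    (hx : x' ∈ T x) : FitzLe T x x' (x' x) := by
  intro y y' hy
  have h := hT x y x' y' hx hy
  simp only [map_sub, sub_apply] at h
  linarith

theorem FitzLe.le_of_mem_domOp {T : X → Set (Dual' X)} {x : X} {x' : Dual' X} {c : ℝ}
    (hx : FitzLe T x x' c) (hdom : x ∈ domOp T) : x' x ≤ c := by
  obtain ⟨w', hw⟩ := hdom
  have h := hx x w' hw
  linarith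

theorem MonotoneOp.opSum {A B : X → Set (Dual' X)} (hA : MonotoneOp A) (hB : MonotoneOp B) :
    MonotoneOp (opSum A B) := by
  rintro x y _ _ ⟨a, ha, b, hb, rfl⟩ ⟨c, hc, d, hd, rfl⟩
  have h1 := hA x y a c ha hc
  have h2 := hB x y b d hb hd
  simp only [map_sub, sub_apply, add_apply] at *
  linarith

/-- A maximal monotone operator is locally bounded at the interior points of its domain. -/
theorem exists_boundedOnBall [CompleteSpace X] {B : X → Set (Dual' X)} (hB : MonotoneOp B) {x₀ : X}
    (hx₀ : x₀ ∈ interior (domOp B)) : ∃ r > 0, ∃ M, BoundedOnBall B x₀ r M := by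
  let E : ℝ → Set X := fun k =>
    {x | ∀ y y', y' ∈ B y → ‖y - x₀‖ ≤ 1 → y' (x - y) ≤ k}
  have hE : ∀ x ∈ domOp B, ∃ k, x ∈ E k := by
    rintro x ⟨x', hx⟩
    refine ⟨‖x'‖ * (‖x - x₀‖ + 1), fun y y' hy hy1 => ?_⟩
    have h := hB x y x' y' hx hy
    rw [sub_apply] at h
    have h2 := apply_le_mul_norm (le_refl ‖x'‖) (x - y)
    have h3 : ‖x - y‖ ≤ ‖x - x₀‖ + 1 := by
      have := norm_sub_le_norm_sub_add_norm_sub x x₀ y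
      rw [norm_sub_rev x₀ y] at this
      linarith
    have := mul_le_mul_of_nonneg_left h3 (norm_nonneg x')
    linarith
  have hEmono : ∀ k l, k ≤ l → E k ⊆ E l := fun k l hkl x hx y y' hy hy1 =>
    (hx y y' hy hy1).trans hkl
  let S : ℕ × ℕ → Set X := fun p =>
    {v | x₀ + (1 / ((p.1 : ℝ) + 1)) • v ∈ E p.2 ∧ x₀ + (1 / ((p.1 : ℝ) + 1)) • (-v) ∈ E p.2}
  have hEclosed : ∀ k, IsClosed (E k) := by
    intro k
    simp only [E, Set.ofPred_forall]
    refine isClosed_iInter fun y => isClosed_iInter fun y' => isClosed_iInter fun _ =>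
      isClosed_iInter fun _ => isClosed_le (by fun_prop) continuous_const
  have hSclosed : ∀ p, IsClosed (S p) := fun p =>
    ((hEclosed _).preimage (by fun_prop)).inter ((hEclosed _).preimage (by fun_prop))
  have hScover : ⋃ p, S p = univ := by
    refine eq_univ_of_forall fun v => ?_
    have key : ∀ u : X, ∀ᶠ m : ℕ in atTop, x₀ + (1 / ((m : ℝ) + 1)) • u ∈ domOp B := by
      intro u
      have h1 : Tendsto (fun m : ℕ => x₀ + (1 / ((m : ℝ) + 1)) • u) atTop (nhds x₀) := by
        have := (tendsto_one_div_add_atTop_nhds_zero_nat (𝕜 := ℝ)).smul_const u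
        simpa using this.const_add x₀
      exact h1 (mem_interior_iff_mem_nhds.1 hx₀)
    obtain ⟨m, h1, h2⟩ := ((key v).and (key (-v))).exists
    obtain ⟨k, hk⟩ := hE _ h1
    obtain ⟨l, hl⟩ := hE _ h2
    obtain ⟨n, hn⟩ := exists_nat_ge (max k l)
    exact mem_iUnion.2 ⟨(m, n), hEmono _ _ ((le_max_left _ _).trans hn) hk,
      hEmono _ _ ((le_max_right _ _).trans hn) hl⟩
  obtain ⟨⟨m, n⟩, v, hv⟩ := nonempty_interior_of_iUnion_of_closed hSclosed hScover
  obtain ⟨s, hs, hball⟩ := Metric.mem_nhds_iff.1 (mem_interior_iff_mem_nhds.1 hv)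
  have hm : (0 : ℝ) < (m : ℝ) + 1 := by positivity
  have hEball : ∀ u : X, ‖u‖ < s / (m + 1) → x₀ + u ∈ E n := by
    intro u hu y y' hy hy1
    have hu' : ‖((m : ℝ) + 1) • u‖ < s := by
      rw [norm_smul, Real.norm_of_nonneg hm.le]
      rwa [lt_div_iff₀ hm, mul_comm] at hu
    have h1 := (hball (show v + ((m : ℝ) + 1) • u ∈ Metric.ball v s by
      rwa [mem_ball_iff_norm, add_sub_cancel_left])).1 y y' hy hy1
    have h2 := (hball (show v - ((m : ℝ) + 1) • u ∈ Metric.ball v s by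
      rwa [mem_ball_iff_norm, sub_sub_cancel_left, norm_neg])).2 y y' hy hy1
    simp only [map_add, map_sub, map_neg, map_smul, smul_eq_mul] at h1 h2 ⊢
    field_simp at h1 h2
    have : 0 ≤ ((m : ℝ) + 1) * (n - (y' x₀ + y' u - y' y)) := by linarith
    have := nonneg_of_mul_nonneg_right this hm
    linarith
  obtain ⟨ρ, hρ, hρB⟩ := Metric.mem_nhds_iff.1 (mem_interior_iff_mem_nhds.1 hx₀)
  have hδ : 0 < s / (m + 1) := by positivity
  set δ := s / ((m : ℝ) + 1)
  refine ⟨min (δ / 3) (min 1 (ρ / 2)), by positivity, 3 * n / δ, fun y hy => ⟨?_, ?_⟩⟩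
  · apply hρB
    rw [mem_ball_iff_norm]
    have := (hy.trans (min_le_right _ _)).trans (min_le_right _ _)
    linarith
  · intro y' hy'
    refine opNorm_le_of_forall_le fun e he => ?_
    have hn : ‖(y - x₀) + (δ / 3) • e‖ < δ := by
      have h1 := norm_add_le (y - x₀) ((δ / 3) • e)
      rw [norm_smul, Real.norm_of_nonneg (by positivity)] at h1
      have h2 := hy.trans (min_le_left _ _)
      nlinarith
    have h := hEball _ hn y y' hy' ((hy.trans (min_le_right _ _)).trans (min_le_left _ _))
    have h3 : x₀ + (y - x₀ + (δ / 3) • e) - y = (δ / 3) • e := by abel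
    rw [h3, map_smul, smul_eq_mul] at h
    rw [le_div_iff₀ hδ]
    linarith

theorem BoundedOnBall.neg_mul_norm_le {B : X → Set (Dual' X)} {x₀ : X} {r M : ℝ}
    (hM : BoundedOnBall B x₀ r M) (hB : MonotoneOp B) {a c : X} {b : Dual' X} (hb : b ∈ B a)
    (hc : ‖c - x₀‖ ≤ r) : -(M * ‖a - c‖) ≤ b (a - c) := by
  obtain ⟨⟨c', hc'⟩, hcM⟩ := hM c hc
  have h := hB a c b c' hb hc'
  rw [sub_apply] at h
  have := neg_mul_norm_le_apply (hcM c' hc') (a - c)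
  linarith

/-- On the convex hull of `z` and of a ball where `B` is bounded by `M`, the values of `B` are
bounded below by `-M` in the direction of `z`. -/
theorem BoundedOnBall.neg_mul_norm_le_toward {B : X → Set (Dual' X)} {x₀ : X} {r M : ℝ}
    (hM : BoundedOnBall B x₀ r M) (hB : MonotoneOp B) {z c : X} {t : ℝ} (ht0 : 0 ≤ t) (ht1 : t ≤ 1)
    (hc : ‖c - x₀‖ ≤ r) {b : Dual' X} (hb : b ∈ B (c + t • (z - c))) :
    -(M * ((1 - t) * ‖z - c‖)) ≤ (1 - t) * b (z - c) := by
  rcases ht0.eq_or_lt with rfl | ht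
  · rw [zero_smul, add_zero] at hb
    simpa using neg_mul_norm_le_apply ((hM c hc).2 b hb) (z - c)
  · have h := hM.neg_mul_norm_le hB hb hc
    rw [add_sub_cancel_left, norm_smul, Real.norm_of_nonneg ht0, map_smul, smul_eq_mul] at h
    have h2 : 0 ≤ t * (b (z - c) + M * ‖z - c‖) := by linarith
    have h3 := nonneg_of_mul_nonneg_right h2 ht
    nlinarith [mul_nonneg (sub_nonneg.2 ht1) h3]

/-- A monotone operator bounded near `x₀` is locally bounded on the half-open segment from `x₀` to
any point of the closure of its domain. -/
theorem BoundedOnBall.locally_bounded {B : X → Set (Dual' X)} {x₀ : X} {r M : ℝ}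
    (hM : BoundedOnBall B x₀ r M) (hB : MonotoneOp B) (hr : 0 < r) {z : X}
    (hz : z ∈ closure (domOp B)) {t : ℝ} (ht0 : 0 ≤ t) (ht1 : t < 1) :
    ∃ η > 0, ∃ N, ∀ a, ‖a - ((1 - t) • x₀ + t • z)‖ ≤ η → ∀ b ∈ B a, ‖b‖ ≤ N := by
  have ht : 0 < 1 - t := by linarith
  have hM0 : 0 ≤ M := by
    obtain ⟨⟨b, hb⟩, h⟩ := hM x₀ (by simpa using hr.le)
    exact (norm_nonneg b).trans (h b hb)
  set w := (1 - t) • x₀ + t • z with hw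
  set η := (1 - t) * r / 4 with hη
  have hη0 : 0 < η := by positivity
  obtain ⟨y, ⟨y', hy'⟩, hyz⟩ := Metric.mem_closure_iff.1 hz η hη0
  rw [dist_comm, dist_eq_norm] at hyz
  refine ⟨η, hη0, (‖y'‖ * (‖y - w‖ + η) + M * (η + ‖w - x₀‖ + r)) / ((1 - t) * (r / 2)),
    fun a ha b hb => opNorm_le_of_forall_le fun e he => ?_⟩
  set d := (1 - t)⁻¹ • ((a - w) - t • (y - z)) + (r / 2) • e with hd
  have hdn : ‖d‖ ≤ r := by
    have h1 : ‖(a - w) - t • (y - z)‖ ≤ η + η := by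
      refine (norm_sub_le _ _).trans (add_le_add ha ?_)
      rw [norm_smul, Real.norm_of_nonneg ht0]
      nlinarith [norm_nonneg (y - z)]
    have h2 : ‖(r / 2) • e‖ ≤ r / 2 := by
      rw [norm_smul, Real.norm_of_nonneg (by positivity)]
      nlinarith
    have h3 : ‖(1 - t)⁻¹ • ((a - w) - t • (y - z))‖ ≤ r / 2 := by
      rw [norm_smul, Real.norm_of_nonneg (by positivity), inv_mul_le_iff₀ ht]
      linarith
    have := norm_add_le ((1 - t)⁻¹ • ((a - w) - t • (y - z))) ((r / 2) • e)
    linarith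
  have hdl := hM.neg_mul_norm_le hB hb (c := x₀ + d) (by rwa [add_sub_cancel_left])
  have hac : ‖a - (x₀ + d)‖ ≤ η + ‖w - x₀‖ + r := by
    have : a - (x₀ + d) = (a - w) + (w - x₀) - d := by abel
    rw [this]
    exact (norm_sub_le _ _).trans (add_le_add ((norm_add_le _ _).trans (by gcongr)) hdn)
  have hya := hB y a y' b hy' hb
  rw [sub_apply] at hya
  have hyn : ‖y - a‖ ≤ ‖y - w‖ + η := by
    have := norm_sub_le_norm_sub_add_norm_sub y w a
    rw [norm_sub_rev w a] at this
    linarith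
  have hy1 := apply_le_mul_norm (le_refl ‖y'‖) (y - a)
  have hid : (1 - t) * (r / 2) * b e = t * b (y - a) - (1 - t) * b (a - (x₀ + d)) := by
    simp only [hd, hw, map_add, map_sub, map_smul, smul_eq_mul]
    field_simp
    ring
  have hu : b (y - a) ≤ ‖y'‖ * (‖y - w‖ + η) := by
    have := mul_le_mul_of_nonneg_left hyn (norm_nonneg y')
    linarith
  have hu0 : 0 ≤ ‖y'‖ * (‖y - w‖ + η) := by positivity
  have hl : -(M * (η + ‖w - x₀‖ + r)) ≤ b (a - (x₀ + d)) := by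
    have := mul_le_mul_of_nonneg_left hac hM0
    linarith
  have hl0 : 0 ≤ M * (η + ‖w - x₀‖ + r) := by positivity
  rw [le_div_iff₀ (by positivity), mul_comm, hid]
  nlinarith

theorem FPV.exists_lt {A : X → Set (Dual' X)} (hA : FPV A) {U : Set X} (hU : IsOpen U)
    (hUc : Convex ℝ U) (hUA : (U ∩ domOp A).Nonempty) {z : X} (hzU : z ∈ U) (hz : z ∉ domOp A)
    (z' : Dual' X) : ∃ a ∈ U, ∃ a' ∈ A a, z' (z - a) < a' (z - a) := by
  by_contra! h
  refine hz ⟨z', hA.2 U hU hUc hUA z z' hzU fun y y' hy hyU => ?_⟩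
  rw [sub_apply]
  linarith [h y hyU y' hy]

theorem FitzLe.apply_sub_le {A B : X → Set (Dual' X)} {z : X} {z' : Dual' X} {c : ℝ}
    (h : FitzLe (opSum A B) z z' c) {a : X} {a' b' : Dual' X} (ha : a' ∈ A a) (hb : b' ∈ B a) :
    z' a + a' (z - a) + b' (z - a) ≤ c := by
  have := h a _ (add_mem_add ha hb)
  simp only [map_sub, add_apply] at *
  linarith

theorem FitzLe.le_of_locally_bounded {A B : X → Set (Dual' X)} (hA : FPV A)
    (hAB : domOp A ⊆ domOp B) {z : X} (hzA : z ∈ closure (domOp A)) (hz : z ∉ domOp A)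
    {η N : ℝ} (hη : 0 < η) (hN : ∀ a, ‖a - z‖ ≤ η → ∀ b ∈ B a, ‖b‖ ≤ N) {z' : Dual' X} {c : ℝ}
    (h : FitzLe (opSum A B) z z' c) : z' z ≤ c := by
  have hlim : Tendsto (fun ε : ℝ => c + N * ε) (nhdsWithin 0 (Ioi 0)) (nhds c) := by
    have : Tendsto (fun ε : ℝ => c + N * ε) (nhds 0) (nhds (c + N * 0)) :=
      (by fun_prop : Continuous fun ε : ℝ => c + N * ε).tendsto 0
    rw [mul_zero, add_zero] at this
    exact this.mono_left nhdsWithin_le_nhds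
  refine ge_of_tendsto hlim ?_
  filter_upwards [Ioo_mem_nhdsGT hη] with ε hε
  obtain ⟨a₀, ha₀, ha₀'⟩ := Metric.mem_closure_iff.1 hzA ε hε.1
  obtain ⟨a, haU, a', ha', hlt⟩ := hA.exists_lt Metric.isOpen_ball (convex_ball z ε)
    ⟨a₀, by rwa [Metric.mem_ball, dist_comm], ha₀⟩ (Metric.mem_ball_self hε.1) hz z'
  rw [mem_ball_iff_norm] at haU
  obtain ⟨b', hb'⟩ := hAB ⟨a', ha'⟩
  have hb := hN a (haU.le.trans hε.2.le) b' hb'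
  have h1 := h.apply_sub_le ha' hb'
  have h2 := neg_mul_norm_le_apply hb (z - a)
  have h3 : N * ‖z - a‖ ≤ N * ε := by
    rw [norm_sub_rev]
    exact mul_le_mul_of_nonneg_left haU.le ((norm_nonneg _).trans hb)
  rw [map_sub z'] at hlt
  linarith

/-- The Fitzpatrick function of `A + B` is infinite off the closure of the domain of `A`. -/
theorem not_fitzLe_of_notMem_closure {A B : X → Set (Dual' X)} (hA : FPV A) (hB : MonotoneOp B)
    (hAB : domOp A ⊆ domOp B) {x₀ : X} (hx₀ : x₀ ∈ domOp A) {r M : ℝ} (hr : 0 < r)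
    (hM : BoundedOnBall B x₀ r M) {z : X} (hz : z ∉ closure (domOp A)) (z' : Dual' X) (c : ℝ) :
    ¬ FitzLe (opSum A B) z z' c := by
  intro h
  have hM0 : 0 ≤ M := by
    obtain ⟨⟨b, hb⟩, h⟩ := hM x₀ (by simpa using hr.le)
    exact (norm_nonneg b).trans (h b hb)
  obtain ⟨σ, hσ, hσA⟩ : ∃ σ > 0, ∀ a ∈ domOp A, σ ≤ ‖z - a‖ := by
    simpa [Metric.mem_closure_iff, dist_eq_norm] using hz
  have hv : 0 < ‖z - x₀‖ := hσ.trans_le (hσA x₀ hx₀)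
  obtain ⟨g, hg1, hgv⟩ := exists_dual_vector ℝ (z - x₀) hv.ne'
  have hgv : g (z - x₀) = ‖z - x₀‖ := by simpa using hgv
  set V := ‖z - x₀‖ with hV
  set R := V + σ
  set ε := min (σ / 4) (r * σ / (2 * V)) with hε
  have hε0 : 0 < ε := by positivity
  have hε1 : ε ≤ σ / 4 := min_le_left _ _
  have hε2 : ε ≤ r * σ / (2 * V) := min_le_right _ _
  set K := (|c| + M * R + ‖z'‖ * (‖z‖ + R) + 1) / (σ / 4) with hK
  have hK0 : 0 ≤ K := by positivity
  obtain ⟨a, haU, a', ha', hlt⟩ := hA.exists_lt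
    (Metric.isOpen_thickening (δ := ε) (E := segment ℝ x₀ z))
    ((convex_segment x₀ z).thickening ε)
    ⟨x₀, Metric.self_subset_thickening hε0 _ (left_mem_segment ℝ x₀ z), hx₀⟩
    (Metric.self_subset_thickening hε0 _ (right_mem_segment ℝ x₀ z))
    (fun hzA => hz (subset_closure hzA)) (K • g)
  obtain ⟨p, hp, hap⟩ := Metric.mem_thickening_iff.1 haU
  rw [segment_eq_image'] at hp
  obtain ⟨t, ⟨ht0, ht1⟩, rfl⟩ := hp
  rw [dist_eq_norm] at hap
  obtain ⟨b', hb'⟩ := hAB ⟨a', ha'⟩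
  set d := a - (x₀ + t • (z - x₀)) with hd
  have hza : z - a = (1 - t) • (z - x₀) - d := by rw [hd]; module
  have hzan : ‖z - a‖ ≤ (1 - t) * V + ε := by
    rw [hza]
    refine (norm_sub_le _ _).trans (add_le_add ?_ hap.le)
    rw [norm_smul, Real.norm_of_nonneg (by linarith)]
  have hσa := hσA a ⟨a', ha'⟩
  have hσt : σ / 2 ≤ (1 - t) * V := by linarith
  have ht : 0 < 1 - t := pos_of_mul_pos_left (by linarith : 0 < (1 - t) * V) hv.le
  have hεr : ε ≤ r * (1 - t) := by
    refine hε2.trans ?_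
    rw [div_le_iff₀ (by positivity)]
    nlinarith
  have hzaR : ‖z - a‖ ≤ R := by
    have : (1 - t) * V ≤ V := by nlinarith
    linarith
  have hc : ‖(x₀ + (1 - t)⁻¹ • d) - x₀‖ ≤ r := by
    rw [add_sub_cancel_left, norm_smul, Real.norm_of_nonneg (by positivity),
      inv_mul_le_iff₀ ht, mul_comm]
    linarith
  have hzc : z - a = (1 - t) • (z - (x₀ + (1 - t)⁻¹ • d)) := by
    rw [← sub_sub, smul_sub, smul_inv_smul₀ ht.ne', hza]
  have hac : a = (x₀ + (1 - t)⁻¹ • d) + t • (z - (x₀ + (1 - t)⁻¹ • d)) := by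
    have : z - a = (z - (x₀ + (1 - t)⁻¹ • d)) - t • (z - (x₀ + (1 - t)⁻¹ • d)) := by
      rw [hzc, sub_smul, one_smul]
    rw [← sub_sub_self z a, this]
    abel
  have hbl : -(M * ‖z - a‖) ≤ b' (z - a) := by
    rw [hac] at hb'
    have := hM.neg_mul_norm_le_toward hB ht0 ht1 hc hb'
    rwa [hzc, norm_smul, Real.norm_of_nonneg ht.le, map_smul, smul_eq_mul]
  have h1 := h.apply_sub_le ha' hb'
  have h2 : M * ‖z - a‖ ≤ M * R := mul_le_mul_of_nonneg_left hzaR hM0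
  have h3 : -(‖z'‖ * (‖z‖ + R)) ≤ z' a := by
    have h4 := neg_mul_norm_le_apply (le_refl ‖z'‖) a
    have h5 : ‖a‖ ≤ ‖z‖ + R := by
      have := norm_sub_norm_le a z
      rw [norm_sub_rev] at this
      linarith
    have := mul_le_mul_of_nonneg_left h5 (norm_nonneg z')
    linarith
  have h6 : σ / 4 ≤ g (z - a) := by
    rw [hza, map_sub, map_smul, hgv, smul_eq_mul]
    have := apply_le_mul_norm hg1.le d
    linarith
  have h7 : K * (σ / 4) ≤ K * g (z - a) := mul_le_mul_of_nonneg_left h6 hK0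
  have h8 : K * (σ / 4) = |c| + M * R + ‖z'‖ * (‖z‖ + R) + 1 := by
    rw [hK]; field_simp
  rw [smul_apply, smul_eq_mul] at hlt
  linarith [le_abs_self c]

/-- Under the hypotheses of the sum theorem, the Fitzpatrick function of `A + B` dominates the
duality product. -/
theorem FitzLe.le {A B : X → Set (Dual' X)} (hA : FPV A) (hB : MonotoneOp B)
    (hAB : domOp A ⊆ domOp B) {x₀ : X} (hx₀ : x₀ ∈ domOp A) {r M : ℝ} (hr : 0 < r)
    (hM : BoundedOnBall B x₀ r M) {z : X} {z' : Dual' X} {c : ℝ}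
    (h : FitzLe (opSum A B) z z' c) : z' z ≤ c := by
  have hdom : domOp A ⊆ domOp (opSum A B) := by
    rintro x ⟨a, ha⟩
    obtain ⟨b, hb⟩ := hAB ⟨a, ha⟩
    exact ⟨a + b, add_mem_add ha hb⟩
  have hz : z ∈ closure (domOp A) := by
    by_contra hz
    exact not_fitzLe_of_notMem_closure hA hB hAB hx₀ hr hM hz z' c h
  obtain ⟨x', hx'⟩ := hdom hx₀
  have hx := FitzLe.of_mem (hA.1.1.opSum hB) hx'
  have key : ∀ t ∈ Ioo (0 : ℝ) 1,
      ((1 - t) • x' + t • z') ((1 - t) • x₀ + t • z) ≤ (1 - t) * x' x₀ + t * c := by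
    intro t ht
    have hw := hx.convex_comb h (sub_nonneg.2 ht.2.le) ht.1.le (sub_add_cancel 1 t)
    by_cases h1 : (1 - t) • x₀ + t • z ∈ domOp A
    · exact hw.le_of_mem_domOp (hdom h1)
    by_cases h2 : (1 - t) • x₀ + t • z ∈ closure (domOp A)
    · obtain ⟨η, hη, N, hN⟩ := hM.locally_bounded hB hr (closure_mono hAB hz) ht.1.le ht.2
      exact hw.le_of_locally_bounded hA hAB h2 h1 hη hN
    · exact absurd hw (not_fitzLe_of_notMem_closure hA hB hAB hx₀ hr hM h2 _ _)
  have hmem : Ioo (0 : ℝ) 1 ∈ nhdsWithin 1 (Iio 1) := Ioo_mem_nhdsLT zero_lt_one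
  have hl : Tendsto (fun t : ℝ => ((1 - t) • x' + t • z') ((1 - t) • x₀ + t • z))
      (nhdsWithin 1 (Iio 1)) (nhds (z' z)) := by
    have : Continuous fun t : ℝ => ((1 - t) • x' + t • z') ((1 - t) • x₀ + t • z) := by fun_prop
    simpa using (this.tendsto 1).mono_left nhdsWithin_le_nhds
  have hr' : Tendsto (fun t : ℝ => (1 - t) * x' x₀ + t * c)
      (nhdsWithin 1 (Iio 1)) (nhds c) := by
    have : Continuous fun t : ℝ => (1 - t) * x' x₀ + t * c := by fun_prop
    simpa using (this.tendsto 1).mono_left nhdsWithin_le_nhds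
  exact le_of_tendsto_of_tendsto hl hr' (by filter_upwards [hmem] with t ht using key t ht)

/-- If the Fitzpatrick function of `T` dominates the duality product, it lies above its tangent at
every pair monotonically related to `T`. -/
theorem FitzLe.tangent_le {T : X → Set (Dual' X)}
    (hT : ∀ {x x' c}, FitzLe T x x' c → x' x ≤ c) {z : X} {z' : Dual' X}
    (hz : FitzLe T z z' (z' z)) {x : X} {x' : Dual' X} {c : ℝ} (hx : FitzLe T x x' c) :
    z' x + x' z - z' z ≤ c := by
  have hlim : Tendsto (fun t : ℝ => z' x + x' z - z' z + t * (x' - z') (x - z))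
      (nhdsWithin 0 (Ioi 0)) (nhds (z' x + x' z - z' z)) := by
    have : Continuous fun t : ℝ => z' x + x' z - z' z + t * (x' - z') (x - z) := by fun_prop
    simpa using (this.tendsto 0).mono_left nhdsWithin_le_nhds
  refine le_of_tendsto hlim ?_
  filter_upwards [Ioo_mem_nhdsGT (zero_lt_one (α := ℝ))] with t ht
  have h := hT (hz.convex_comb hx (sub_nonneg.2 ht.2.le) ht.1.le (sub_add_cancel 1 t))
  simp only [map_add, map_sub, map_smul, add_apply,
    sub_apply, smul_apply, smul_eq_mul] at h ⊢
  refine le_of_mul_le_mul_left ?_ ht.1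
  linarith

/-- If the convex set `P` lies above the convex set `Q` in every fibre of `X × ℝ`, and `Q` contains
a downward cylinder over a ball, then some affine function lies between `Q` and `P`. -/
theorem exists_affine_between {P Q : Set (X × ℝ)} (hP : Convex ℝ P) (hQ : Convex ℝ Q)
    (hPQ : ∀ x s t, (x, s) ∈ P → (x, t) ∈ Q → t ≤ s) {x₀ : X} {δ k ρ : ℝ} (hδ : 0 < δ)
    (hcyl : ∀ x, ‖x - x₀‖ ≤ δ → ∀ t ≤ k, (x, t) ∈ Q) (hup : ∀ s ≥ ρ, (x₀, s) ∈ P) :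
    ∃ (u : Dual' X) (c : ℝ), (∀ p ∈ P, u p.1 + c ≤ p.2) ∧ ∀ q ∈ Q, q.2 ≤ u q.1 + c := by
  have hint : (x₀, k - 1) ∈ interior Q := by
    rw [mem_interior_iff_mem_nhds]
    refine mem_of_superset (prod_mem_nhds (Metric.closedBall_mem_nhds x₀ hδ)
      (Iic_mem_nhds (sub_one_lt k))) ?_
    rintro ⟨x, t⟩ ⟨hx, ht⟩
    exact hcyl x (by simpa [dist_eq_norm] using hx) t ht
  have hdisj : Disjoint (interior Q) P := by
    rw [Set.disjoint_left]
    rintro ⟨x, s⟩ hq hp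
    have hlim : Tendsto (fun ε : ℝ => (x, s + ε)) (nhdsWithin 0 (Ioi 0)) (nhds (x, s)) := by
      have : Continuous fun ε : ℝ => (x, s + ε) := by fun_prop
      simpa using (this.tendsto 0).mono_left nhdsWithin_le_nhds
    obtain ⟨ε, hε, hε0⟩ := ((hlim.eventually_mem (mem_interior_iff_mem_nhds.1 hq)).and
      eventually_mem_nhdsWithin).exists
    have h1 := hPQ x s (s + ε) hp hε
    rw [mem_Ioi] at hε0
    linarith
  obtain ⟨φ, m, hφQ, hφP⟩ := geometric_hahn_banach_open hQ.interior isOpen_interior hP hdisj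
  have hφQ' : ∀ q ∈ Q, φ q ≤ m := by
    intro q hq
    have hcl : q ∈ closure (interior Q) := by
      rw [hQ.closure_interior_eq_closure_of_nonempty_interior ⟨_, hint⟩]
      exact subset_closure hq
    exact closure_minimal (fun y hy => (hφQ y hy).le)
      (isClosed_le φ.continuous continuous_const) hcl
  have hφ : ∀ x t, φ (x, t) = φ (x, 0) + t * φ (0, 1) := by
    intro x t
    rw [← smul_eq_mul, ← map_smul, ← map_add]
    simp
  set κ := φ (0, 1)
  have h1 := hφQ _ hint
  rw [hφ] at h1
  have h2 := hφP _ (hup (max ρ k) (le_max_left _ _))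
  rw [hφ] at h2
  have hκ : 0 < κ := by
    have : 0 < (max ρ k - (k - 1)) * κ := by linarith
    exact pos_of_mul_pos_right this (by linarith [le_max_right ρ k])
  refine ⟨-κ⁻¹ • φ.comp (ContinuousLinearMap.inl ℝ X ℝ), m / κ, fun p hp => ?_, fun q hq => ?_⟩
  · have h := hφP p hp
    rw [← Prod.mk.eta (p := p), hφ] at h
    simp only [smul_apply, ContinuousLinearMap.comp_apply,
      ContinuousLinearMap.inl_apply, smul_eq_mul]
    field_simp
    linarith
  · have h := hφQ' q hq
    rw [← Prod.mk.eta (p := q), hφ] at h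
    simp only [smul_apply, ContinuousLinearMap.comp_apply,
      ContinuousLinearMap.inl_apply, smul_eq_mul]
    field_simp
    linarith

theorem mem_opSum_of_fitzLe {A B : X → Set (Dual' X)} (hA : MaxMonotone A) (hB : MaxMonotone B)
    (hAB : ∀ {x x' c}, FitzLe (opSum A B) x x' c → x' x ≤ c) {x₀ : X} (hx₀ : x₀ ∈ domOp A)
    {r M : ℝ} (hr : 0 < r) (hM : BoundedOnBall B x₀ r M) {z : X} {z' : Dual' X}
    (hz : FitzLe (opSum A B) z z' (z' z)) : z' ∈ opSum A B z := by
  let P : Set (X × ℝ) := {p | ∃ a', FitzLe A p.1 a' (p.2 + a' z)}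
  let Q : Set (X × ℝ) := {q | ∃ b', FitzLe B q.1 b' (z' q.1 - z' z - q.2 + b' z)}
  have hP : Convex ℝ P := by
    rintro ⟨x, ρ⟩ ⟨a, ha⟩ ⟨y, τ⟩ ⟨b, hb⟩ s t hs ht hst
    change ∃ a', FitzLe A (s • x + t • y) a' ((s * ρ + t * τ) + a' z)
    refine ⟨s • a + t • b, ?_⟩
    convert ha.convex_comb hb hs ht hst using 1
    simp only [add_apply, smul_apply, smul_eq_mul]
    ring
  have hQ : Convex ℝ Q := by
    rintro ⟨x, ρ⟩ ⟨a, ha⟩ ⟨y, τ⟩ ⟨b, hb⟩ s t hs ht hst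
    change ∃ b', FitzLe B (s • x + t • y) b'
      (z' (s • x + t • y) - z' z - (s * ρ + t * τ) + b' z)
    refine ⟨s • a + t • b, ?_⟩
    convert ha.convex_comb hb hs ht hst using 1
    simp only [map_add, map_smul, add_apply, smul_apply, smul_eq_mul]
    linear_combination (z' z) * hst
  have hPQ : ∀ x s t, (x, s) ∈ P → (x, t) ∈ Q → t ≤ s := by
    rintro x s t ⟨a, ha⟩ ⟨b, hb⟩
    have hab : FitzLe (opSum A B) x (a + b) ((s + a z) + (z' x - z' z - t + b z)) := by
      rintro y _ ⟨c, hc, d, hd, rfl⟩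
      have h1 := ha y c hc
      have h2 := hb y d hd
      simp only [add_apply] at *
      linarith
    have h := FitzLe.tangent_le hAB hz hab
    rw [add_apply] at h
    linarith
  have hmono : ∀ {T : X → Set (Dual' X)} {x x' c d}, FitzLe T x x' c → c ≤ d → FitzLe T x x' d :=
    fun h hcd y y' hy => (h y y' hy).trans hcd
  have hAP : ∀ x a', a' ∈ A x → ∀ s ≥ a' (x - z), (x, s) ∈ P := by
    intro x a' ha s hs
    refine ⟨a', hmono (FitzLe.of_mem hA.1 ha) ?_⟩
    rw [map_sub] at hs
    linarith
  have hBQ : ∀ x b', b' ∈ B x → ∀ t ≤ (z' - b') (x - z), (x, t) ∈ Q := by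
    intro x b' hb t ht
    refine ⟨b', hmono (FitzLe.of_mem hB.1 hb) ?_⟩
    simp only [map_sub, sub_apply] at ht
    linarith
  obtain ⟨a₀, ha₀⟩ := hx₀
  have hcyl : ∀ x, ‖x - x₀‖ ≤ r →
      ∀ t ≤ -((‖z'‖ + M) * (r + ‖x₀ - z‖)), (x, t) ∈ Q := by
    intro x hx t ht
    obtain ⟨⟨b', hb'⟩, hbM⟩ := hM x hx
    refine hBQ x b' hb' t (ht.trans ?_)
    have h1 : ‖z' - b'‖ ≤ ‖z'‖ + M := (norm_sub_le _ _).trans (by gcongr; exact hbM b' hb')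
    refine le_trans ?_ (neg_mul_norm_le_apply h1 _)
    have h2 : ‖x - z‖ ≤ r + ‖x₀ - z‖ :=
      (norm_sub_le_norm_sub_add_norm_sub x x₀ z).trans (by gcongr)
    have := mul_le_mul_of_nonneg_left h2 ((norm_nonneg _).trans h1)
    linarith
  obtain ⟨u, c, hu, hv⟩ := exists_affine_between hP hQ hPQ hr hcyl (hAP x₀ a₀ ha₀)
  have huA : ∀ y y', y' ∈ A y → u z + c ≤ (u - y') (z - y) := by
    intro y y' hy
    have := hu _ (hAP y y' hy _ le_rfl)
    simp only [map_sub, sub_apply] at *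
    linarith
  have hvB : ∀ y y', y' ∈ B y → -(u z + c) ≤ (z' - u - y') (z - y) := by
    intro y y' hy
    have := hv _ (hBQ y y' hy _ le_rfl)
    simp only [map_sub, sub_apply] at *
    linarith
  have hzA : 0 ≤ u z + c → u ∈ A z := fun h =>
    hA.2 z u fun y y' hy => h.trans (huA y y' hy)
  have hzB : u z + c ≤ 0 → z' - u ∈ B z := fun h =>
    hB.2 z (z' - u) fun y y' hy => (neg_nonneg.2 h).trans (hvB y y' hy)
  have h0 : u z + c = 0 := by
    rcases le_total 0 (u z + c) with h | h
    · have := huA z u (hzA h)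
      rw [sub_self z, map_zero] at this
      exact le_antisymm this h
    · have := hvB z _ (hzB h)
      rw [sub_self z, map_zero] at this
      linarith
  exact ⟨u, hzA h0.ge, z' - u, hzB h0.le, add_sub_cancel _ _⟩

/-- Sum theorem for `A` of type (FPV) whose domain is contained in that of `B`. -/
theorem FPV.maxMonotone_opSum [CompleteSpace X] {A B : X → Set (Dual' X)} (hA : FPV A)
    (hB : MaxMonotone B) (hAB : domOp A ⊆ domOp B)
    (hint : (domOp A ∩ interior (domOp B)).Nonempty) : MaxMonotone (opSum A B) := by
  obtain ⟨x₀, hx₀, hx₀'⟩ := hint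
  obtain ⟨r, hr, M, hM⟩ := exists_boundedOnBall hB.1 hx₀'
  refine ⟨hA.1.1.opSum hB.1, fun z z' hz => ?_⟩
  refine mem_opSum_of_fitzLe hA.1 hB (FitzLe.le hA hB.1 hAB hx₀ hr hM) hx₀ hr hM ?_
  intro y y' hy
  have := hz y y' hy
  simp only [map_sub, sub_apply] at this
  linarith

theorem domOp_opSum_normalCone (A : X → Set (Dual' X)) (C : Set X) :
    domOp (opSum A (normalCone C)) = domOp A ∩ C := by
  ext x
  constructor
  · rintro ⟨_, a, ha, n, hn, rfl⟩
    exact ⟨⟨a, ha⟩, hn.1⟩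
  · rintro ⟨⟨a, ha⟩, hx⟩
    exact ⟨a + 0, add_mem_add ha ⟨hx, by simp⟩⟩

theorem opSum_normalCone_opSum (A : X → Set (Dual' X)) {B : X → Set (Dual' X)}
    (hB : MaxMonotone B) :
    opSum (opSum A (normalCone (closure (domOp B)))) B = opSum A B := by
  funext x
  apply Subset.antisymm
  · rintro _ ⟨_, ⟨a, ha, n, hn, rfl⟩, b, hb, rfl⟩
    refine ⟨a, ha, n + b, hB.2 x _ fun y y' hy => ?_, (add_assoc a n b).symm⟩
    have h1 := hB.1 x y b y' hb hy
    have h2 := hn.2 y (subset_closure ⟨y', hy⟩)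
    simp only [map_sub, sub_apply, add_apply] at *
    linarith
  · rintro _ ⟨a, ha, b, hb, rfl⟩
    exact ⟨a, ⟨a, ha, 0, ⟨subset_closure ⟨b, hb⟩, by simp⟩, add_zero a⟩, b, hb, rfl⟩

end Sum

variable [NormedAddCommGroup X] [NormedSpace ℝ X] [CompleteSpace X]

theorem stmt6 (A B : X → Set (Dual' X)) (hA : MaxMonotone A) (hB : MaxMonotone B)
    (hint : (domOp A ∩ interior (domOp B)).Nonempty)
    (hFPV : FPV (opSum A (normalCone (closure (domOp B)))))
    (hsub : domOp A ∩ closure (domOp B) ⊆ domOp B) :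
    MaxMonotone (opSum A B) := by
  rw [← opSum_normalCone_opSum A hB]
  refine hFPV.maxMonotone_opSum hB ?_ ?_
  · rwa [domOp_opSum_normalCone]
  · obtain ⟨x, hxA, hxB⟩ := hint
    rw [domOp_opSum_normalCone]
    exact ⟨x, ⟨hxA, subset_closure (interior_subset hxB)⟩, hxB⟩
end
end

section
/- Let X be a real Banach space, let A : X ⇉ X* be maximal monotone of type (FPV), and let B : X ⇉ X* be maximal monotone with dom B = X. Then A + B is maximal monotone. -/
open Set Filter Pointwise

noncomputable section

variable {X : Type*}

section Sum
variable [NormedAddCommGroup X] [NormedSpace ℝ X]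

theorem MaxMonotone.domOp_nonempty {A : X → Set (Dual' X)} (hA : MaxMonotone A) :
    (domOp A).Nonempty := by
  by_contra h
  have hempty : ∀ y y', y' ∉ A y := fun y y' hy => h ⟨y, y', hy⟩
  exact hempty 0 0 (hA.2 0 0 fun y y' hy => (hempty y y' hy).elim)

/-- A monotone operator with full domain on a Banach space is locally bounded. -/
theorem MonotoneOp.eventually_norm_le [CompleteSpace X] {B : X → Set (Dual' X)}
    (hB : MonotoneOp B) (hfull : domOp B = univ) (x : X) :
    ∃ M : ℝ, ∀ᶠ y in nhds x, ∀ y' ∈ B y, ‖y'‖ ≤ M := by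
  let ι := {p : X × Dual' X // ‖p.1 - x‖ ≤ 1 ∧ p.2 ∈ B p.1}
  let c : ι → ℝ := fun p => 1 + ‖p.1.2‖ * ‖p.1.1 - x‖
  have hc : ∀ p, 1 ≤ c p := fun p => le_add_of_nonneg_right (by positivity)
  have one_sided : ∀ v : X, ∃ C : ℝ, ∀ p : ι, p.1.2 v ≤ C * c p := by
    intro v
    obtain ⟨v', hv'⟩ : (B (x + v)).Nonempty := by
      have : x + v ∈ domOp B := hfull ▸ mem_univ _
      exact this
    refine ⟨‖v'‖ * (‖v‖ + 1) + 1, fun p => ?_⟩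
    obtain ⟨⟨y, y'⟩, hy, hy'⟩ := p
    have hmono := hB (x + v) y v' y' hv' hy'
    have h₁ : v' (v - (y - x)) ≤ ‖v'‖ * (‖v‖ + 1) :=
      (le_abs_self _).trans <| (v'.le_opNorm _).trans <| by
        gcongr
        exact (norm_sub_le _ _).trans (by simpa using hy)
    have h₂ : y' (y - x) ≤ ‖y'‖ * ‖y - x‖ := (le_abs_self _).trans (y'.le_opNorm _)
    have h₃ : 0 ≤ ‖v'‖ * (‖v‖ + 1) * (‖y'‖ * ‖y - x‖) := by positivity
    simp only [sub_apply, map_sub, map_add, c] at *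
    nlinarith
  obtain ⟨K, hK⟩ : ∃ K, ∀ p : ι, ‖(c p)⁻¹ • p.1.2‖ ≤ K := by
    apply banach_steinhaus
    intro v
    obtain ⟨C₁, h₁⟩ := one_sided v
    obtain ⟨C₂, h₂⟩ := one_sided (-v)
    refine ⟨max C₁ C₂, fun p => ?_⟩
    have hp : 0 < c p := one_pos.trans_le (hc p)
    have h₁ := h₁ p
    have h₂ := h₂ p
    rw [map_neg] at h₂
    rw [smul_apply, smul_eq_mul, Real.norm_eq_abs, abs_mul,
      abs_of_pos (inv_pos.2 hp), inv_mul_le_iff₀ hp, abs_le]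
    constructor <;> nlinarith [le_max_left C₁ C₂, le_max_right C₁ C₂]
  have hK' : 0 < max K 1 := one_pos.trans_le (le_max_right _ _)
  refine ⟨2 * max K 1, ?_⟩
  filter_upwards [Metric.ball_mem_nhds x (show 0 < (2 * max K 1)⁻¹ by positivity)] with y hy y' hy'
  rw [mem_ball_iff_norm] at hy
  have hy₁ : (2 * max K 1)⁻¹ ≤ 1 := inv_le_one_of_one_le₀ (by linarith [le_max_right K 1])
  have h := hK ⟨(y, y'), hy.le.trans hy₁, hy'⟩
  have hp := hc ⟨(y, y'), hy.le.trans hy₁, hy'⟩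
  rw [norm_smul, norm_inv, Real.norm_eq_abs, abs_of_pos (by linarith),
    inv_mul_le_iff₀ (by linarith)] at h
  simp only [c] at h hp
  have h₄ : ‖y - x‖ * (2 * max K 1) ≤ 1 := by
    have := mul_le_mul_of_nonneg_right hy.le (show 0 ≤ 2 * max K 1 by positivity)
    rwa [inv_mul_cancel₀ (by positivity)] at this
  nlinarith [norm_nonneg y', le_max_left K 1]

theorem MonotoneOp.exists_thickening_norm_le [CompleteSpace X] {B : X → Set (Dual' X)}
    (hB : MonotoneOp B) (hfull : domOp B = univ) {K : Set X} (hK : IsCompact K) :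
    ∃ M : ℝ, ∃ r > 0, ∀ y ∈ Metric.thickening r K, ∀ y' ∈ B y, ‖y'‖ ≤ M := by
  obtain ⟨M, hM⟩ : ∃ M : ℝ, ∀ᶠ y in nhdsSet K, ∀ y' ∈ B y, ‖y'‖ ≤ M := by
    refine hK.induction_on (p := fun s => ∃ M : ℝ, ∀ᶠ y in nhdsSet s, ∀ y' ∈ B y, ‖y'‖ ≤ M)
      ⟨0, by simp⟩ ?_ ?_ ?_
    · rintro s t hst ⟨M, hM⟩
      exact ⟨M, hM.filter_mono (nhdsSet_mono hst)⟩
    · rintro s t ⟨M, hM⟩ ⟨N, hN⟩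
      refine ⟨max M N, ?_⟩
      rw [nhdsSet_union, eventually_sup]
      exact ⟨hM.mono fun y hy y' hy' => (hy y' hy').trans (le_max_left _ _),
        hN.mono fun y hy y' hy' => (hy y' hy').trans (le_max_right _ _)⟩
    · intro x _
      obtain ⟨M, hM⟩ := hB.eventually_norm_le hfull x
      exact ⟨_, mem_nhdsWithin_of_mem_nhds (eventually_eventually_nhds.2 hM), M,
        eventually_nhdsSet_iff_forall.2 fun y hy => hy⟩
  obtain ⟨r, hr, h⟩ := (Metric.hasBasis_nhdsSet_thickening hK).mem_iff.1 hM
  exact ⟨M, r, hr, h⟩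

/-- The Fitzpatrick function of `A + B` dominates the duality pairing, up to `ε`. -/
theorem FPV.exists_opSum_ge [CompleteSpace X] {A B : X → Set (Dual' X)} (hA : FPV A)
    (hB : MonotoneOp B) (hfull : domOp B = univ) (z : X) (z' : Dual' X) {ε : ℝ} (hε : 0 < ε) :
    ∃ a, ∃ a' ∈ A a, ∃ b' ∈ B a, -ε ≤ (a' + b' - z') (z - a) := by
  have hB' : ∀ x, (B x).Nonempty := fun x => by
    have : x ∈ domOp B := hfull ▸ mem_univ _
    exact this
  by_cases hz : z ∈ domOp A
  · obtain ⟨a', ha'⟩ := hz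
    obtain ⟨b', hb'⟩ := hB' z
    exact ⟨z, a', ha', b', hb', by simp [hε.le]⟩
  obtain ⟨x, hx⟩ := hA.1.domOp_nonempty
  have hne : z - x ≠ 0 := fun h => hz (sub_eq_zero.1 h ▸ hx)
  obtain ⟨w, hw⟩ := SeparatingDual.exists_eq_one (R := ℝ) hne
  have hcomp : IsCompact (segment ℝ z x) := by
    rw [← convexHull_pair]
    exact (Set.toFinite {z, x}).isCompact_convexHull ℝ
  obtain ⟨M, r₀, hr₀, hM⟩ := hB.exists_thickening_norm_le hfull hcomp
  have hM₀ : 0 ≤ M := by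
    obtain ⟨b', hb'⟩ := hB' z
    exact (norm_nonneg b').trans
      (hM z (Metric.self_subset_thickening hr₀ _ (left_mem_segment ℝ z x)) b' hb')
  let N : ℝ := (M + ‖z'‖) * ‖z - x‖
  have hN : 0 ≤ N := by positivity
  let L : ℝ := N * ‖w‖ + (M + ‖z'‖) + 1
  have hL : 0 < L := by positivity
  let r : ℝ := min r₀ (ε / L)
  have hr : 0 < r := by positivity
  have hrL : r * L ≤ ε := (le_div_iff₀ hL).1 (min_le_right _ _)
  let U := Metric.thickening r (segment ℝ z x)
  obtain ⟨a, a', ha', haU, hneg⟩ : ∃ a a', a' ∈ A a ∧ a ∈ U ∧ (N • w - a') (z - a) < 0 := by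
    by_contra! h
    exact hz ⟨_, hA.2 U Metric.isOpen_thickening ((convex_segment z x).thickening r)
      ⟨x, Metric.self_subset_thickening hr _ (right_mem_segment ℝ z x), hx⟩ z (N • w)
      (Metric.self_subset_thickening hr _ (left_mem_segment ℝ z x)) h⟩
  obtain ⟨b', hb'⟩ := hB' a
  refine ⟨a, a', ha', b', hb', ?_⟩
  have hbM : ‖b'‖ ≤ M := hM a (Metric.thickening_mono (min_le_left _ _) _ haU) b' hb'
  obtain ⟨k, hk, hak⟩ := Metric.mem_thickening_iff.1 haU
  rw [segment_eq_image'] at hk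
  obtain ⟨s, ⟨hs₀, -⟩, rfl⟩ := hk
  obtain ⟨e, he⟩ : ∃ e, z + s • (x - z) - a = e := ⟨_, rfl⟩
  rw [dist_comm, dist_eq_norm, he] at hak
  have hza : z - a = s • (z - x) + e := by
    rw [← he]; module
  have hwe : -(‖w‖ * r) ≤ w e := by
    have h₁ := (abs_le.1 (w.le_opNorm e)).1
    have h₂ := mul_le_mul_of_nonneg_left hak.le (norm_nonneg w)
    linarith
  have hnorm : ‖z - a‖ ≤ s * ‖z - x‖ + r := by
    rw [hza]
    refine (norm_add_le _ _).trans ?_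
    rw [norm_smul, Real.norm_of_nonneg hs₀]
    linarith
  have hbz : -((M + ‖z'‖) * (s * ‖z - x‖ + r)) ≤ (b' - z') (z - a) := by
    have h₁ := (abs_le.1 ((b' - z').le_opNorm (z - a))).1
    have h₂ : ‖b' - z'‖ * ‖z - a‖ ≤ (M + ‖z'‖) * (s * ‖z - x‖ + r) := by
      gcongr
      exact (norm_sub_le _ _).trans (by gcongr)
    linarith
  have hwza : s - ‖w‖ * r ≤ w (z - a) := by
    rw [hza, map_add, map_smul, hw, smul_eq_mul]
    linarith
  have hNw := mul_le_mul_of_nonneg_left hwza hN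
  have ha : N * w (z - a) < a' (z - a) := by
    rw [sub_apply, smul_apply, smul_eq_mul] at hneg
    linarith
  have hsplit : (a' + b' - z') (z - a) = a' (z - a) + (b' - z') (z - a) := by
    rw [add_sub_assoc, add_apply]
  rw [hsplit]
  simp only [N, L] at *
  nlinarith

/-- A convex epigraph-like set whose vertical section over `0` is nonnegative lies above a
continuous linear functional. -/
theorem exists_dual_le_of_convex {C : Set (X × ℝ)} (hC : Convex ℝ C) {r R : ℝ} (hr : 0 < r)
    (hball : ∀ w s, ‖w‖ < r → R < s → (w, s) ∈ C) (hzero : ∀ s, ((0 : X), s) ∈ C → 0 ≤ s) :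
    ∃ y : Dual' X, ∀ w s, (w, s) ∈ C → y w ≤ s := by
  have hint : (interior C).Nonempty := by
    refine ⟨((0 : X), R + 1), mem_interior.2 ⟨Metric.ball 0 r ×ˢ Ioi R, ?_,
      Metric.isOpen_ball.prod isOpen_Ioi, by simp [hr]⟩⟩
    rintro ⟨w, s⟩ ⟨hw, hs⟩
    exact hball w s (by simpa using hw) hs
  have h0 : (0 : X × ℝ) ∉ interior C := by
    intro h
    have hcont : Tendsto (fun s : ℝ => ((0 : X), s)) (nhds 0) (nhds (0 : X × ℝ)) :=
      Continuous.tendsto (by fun_prop) 0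
    obtain ⟨δ, hδ, hδC⟩ := Metric.eventually_nhds_iff.1 (hcont (mem_interior_iff_mem_nhds.1 h))
    have := hzero (-(δ / 2)) (hδC (by simp [abs_of_pos hδ, hδ]))
    linarith
  obtain ⟨f, hf, hfC⟩ := geometric_hahn_banach_of_nonempty_interior_point hC h0 hint
  simp only [map_zero] at hfC
  let g : Dual' X := f.comp (ContinuousLinearMap.inl ℝ X ℝ)
  let κ : ℝ := f (0, 1)
  have hfg : ∀ w s, f (w, s) = g w + s * κ := by
    intro w s
    have : ((w, s) : X × ℝ) = (w, 0) + s • (0, 1) := by simp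
    rw [this, map_add, map_smul, smul_eq_mul]
    rfl
  have hκ : κ ≤ 0 := by
    have := hfC _ (hball 0 (|R| + 1) (by simpa) (by linarith [le_abs_self R]))
    rw [hfg, map_zero, zero_add] at this
    exact nonpos_of_mul_nonpos_right this (by positivity)
  have hκ' : κ < 0 := by
    refine hκ.lt_of_ne fun hκ₀ => hf ?_
    have hg : ∀ v, g v ≤ 0 := by
      intro v
      have ht : 0 < r / (‖v‖ + 1) := by positivity
      have := hfC _ (hball ((r / (‖v‖ + 1)) • v) (R + 1) (by
        rw [norm_smul, Real.norm_of_nonneg ht.le, div_mul_eq_mul_div, div_lt_iff₀ (by positivity)]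
        nlinarith) (by linarith))
      rw [hfg, hκ₀, mul_zero, add_zero, map_smul, smul_eq_mul] at this
      exact nonpos_of_mul_nonpos_right this ht
    have hg₀ : ∀ v, g v = 0 := fun v =>
      le_antisymm (hg v) (by simpa using hg (-v))
    refine ContinuousLinearMap.ext fun ⟨w, s⟩ => ?_
    rw [hfg, hg₀, hκ₀]
    simp
  refine ⟨(-κ)⁻¹ • g, fun w s hws => ?_⟩
  have := hfC _ hws
  rw [hfg] at this
  rw [smul_apply, smul_eq_mul, inv_mul_le_iff₀ (by linarith)]
  linarith

end Sum

variable [NormedAddCommGroup X] [NormedSpace ℝ X] [CompleteSpace X]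

theorem stmt8 (A B : X → Set (Dual' X)) (hA : FPV A) (hB : MaxMonotone B)
    (hfull : domOp B = Set.univ) :
    MaxMonotone (opSum A B) := by
  refine ⟨hA.1.1.opSum hB.1, fun z z' hz => ?_⟩
  have hz' : ∀ a, ∀ a' ∈ A a, ∀ b' ∈ B a, 0 ≤ (a' + b' - z') (a - z) := by
    intro a a' ha' b' hb'
    have := hz a (a' + b') ⟨a', ha', b', hb', rfl⟩
    rwa [← neg_sub (a' + b'), ← neg_sub a, map_neg, neg_apply, neg_neg] at this
  let C : Set (X × ℝ) := {p | ∃ (x : X) (u : Dual' X), ∀ a, ∀ a' ∈ A a, ∀ b' ∈ B a,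
    (a' + b' - z') x + b' p.1 + u (a - z) - (a' + b' - z') (a - z) ≤ p.2}
  have hC : Convex ℝ C := by
    rintro ⟨w₁, s₁⟩ ⟨x₁, u₁, h₁⟩ ⟨w₂, s₂⟩ ⟨x₂, u₂, h₂⟩ α β hα hβ hαβ
    refine ⟨α • x₁ + β • x₂, α • u₁ + β • u₂, fun a a' ha' b' hb' => ?_⟩
    have h₁ := mul_le_mul_of_nonneg_left (h₁ a a' ha' b' hb') hα
    have h₂ := mul_le_mul_of_nonneg_left (h₂ a a' ha' b' hb') hβ
    obtain rfl : β = 1 - α := by linarith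
    simp only [Prod.fst_add, Prod.snd_add, Prod.smul_fst, Prod.smul_snd, smul_eq_mul,
      add_apply, smul_apply, map_add, map_smul] at *
    linarith
  have hmem : ∀ a, ∀ a' ∈ A a, ∀ d, ∀ d' ∈ B d, ∀ s, d' (d - z) + (a' - z') (a - z) ≤ s →
      (d - a, s) ∈ C := by
    intro a a' ha' d d' hd' s hs
    refine ⟨a - z, a' - z' + d', fun e e' he' b' hb' => ?_⟩
    have h₁ := hA.1.1 a e a' e' ha' he'
    have h₂ := hB.1 d e d' b' hd' hb'
    simp only [sub_apply, add_apply, map_sub] at *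
    linarith
  have hzero : ∀ s, ((0 : X), s) ∈ C → 0 ≤ s := by
    rintro s ⟨x, u, h⟩
    by_contra! hs
    obtain ⟨t, ht₀, ht₁, hts⟩ : ∃ t : ℝ, 0 < t ∧ t ≤ 1 ∧ s < t * (u x - 1) := by
      refine ⟨min 1 (-s / (2 * (|u x| + 1))), ?_, min_le_left _ _, ?_⟩
      · have : 0 < -s / (2 * (|u x| + 1)) := div_pos (by linarith) (by positivity)
        positivity
      · set t := min 1 (-s / (2 * (|u x| + 1)))
        have h₁ : t * (2 * (|u x| + 1)) ≤ -s :=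
          (le_div_iff₀ (by positivity)).1 (min_le_right _ _)
        have h₂ : 0 < t := lt_min one_pos (div_pos (by linarith) (by positivity))
        nlinarith [neg_abs_le (u x)]
    obtain ⟨a, a', ha', b', hb', hab⟩ :=
      hA.exists_opSum_ge hB.1 hfull (z + t • x) (z' + t • u) (sq_pos_of_pos ht₀)
    have h := h a a' ha' b' hb'
    have hnn := hz' a a' ha' b' hb'
    set c := a' + b' - z' with hc
    have hexp : (a' + b' - (z' + t • u)) (z + t • x - a)
        = t * c x - c (a - z) - t * (t * u x) + t * u (a - z) := by
      rw [show a' + b' - (z' + t • u) = c - t • u by rw [hc]; abel,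
        show z + t • x - a = t • x - (a - z) by abel]
      simp only [sub_apply, smul_apply, map_sub, map_smul,
        smul_eq_mul]
      ring
    rw [hexp] at hab
    simp only [map_zero, add_zero] at h
    have h₁ := mul_le_mul_of_nonneg_left h ht₀.le
    have h₂ := mul_le_mul_of_nonneg_right ht₁ hnn
    have h₃ := mul_lt_mul_of_pos_left hts ht₀
    nlinarith
  obtain ⟨a₀, a₀', ha₀⟩ := hA.1.domOp_nonempty
  obtain ⟨M, hM⟩ := hB.1.eventually_norm_le hfull a₀
  obtain ⟨r, hr, hrM⟩ := Metric.eventually_nhds_iff.1 hM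
  obtain ⟨y, hy⟩ := exists_dual_le_of_convex hC hr
    (R := M * (‖a₀ - z‖ + r) + (a₀' - z') (a₀ - z)) (by
      intro w s hw hs
      obtain ⟨d', hd'⟩ : (B (a₀ + w)).Nonempty := by
        have : a₀ + w ∈ domOp B := hfull ▸ mem_univ _
        exact this
      have hd'M : ‖d'‖ ≤ M := hrM (by simpa using hw) d' hd'
      have h := hmem a₀ a₀' ha₀ (a₀ + w) d' hd' s
      rw [add_sub_cancel_left] at h
      refine h ?_
      have h₁ : d' (a₀ + w - z) ≤ M * (‖a₀ - z‖ + r) := by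
        refine (le_abs_self _).trans ((d'.le_opNorm _).trans ?_)
        have : ‖a₀ + w - z‖ ≤ ‖a₀ - z‖ + r := by
          rw [add_sub_right_comm]
          exact (norm_add_le _ _).trans (by gcongr)
        gcongr
        exact (norm_nonneg d').trans hd'M
      linarith) hzero
  have key : ∀ a, ∀ a' ∈ A a, ∀ d, ∀ d' ∈ B d,
      0 ≤ (y - d') (z - d) + (z' - y - a') (z - a) := by
    intro a a' ha' d d' hd'
    have := hy _ _ (hmem a a' ha' d d' hd' _ le_rfl)
    simp only [sub_apply, map_sub] at *
    linarith
  have hyB : y ∈ B z := by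
    refine hB.2 z y fun d d' hd' => ?_
    by_contra! hneg
    have hzA : z' - y ∈ A z := hA.1.2 z (z' - y) fun a a' ha' => by
      linarith [key a a' ha' d d' hd']
    have := key z _ hzA d d' hd'
    rw [sub_self z, map_zero] at this
    linarith
  refine ⟨z' - y, hA.1.2 z (z' - y) fun a a' ha' => ?_, y, hyB, sub_add_cancel z' y⟩
  simpa using key a a' ha' z y hyB
end
end
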